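/- An S-graph shift X(G,S), with (G,S) an essential set-equipped graph, has the specification property if and only if it is mixing and has the weak specification property. -/

import Mathlib

open Filter Topology

/-- The shift map on bi-infinite sequences over the alphabet `A`. -/
def shiftMap {A : Type*} (x : ℤ → A) : ℤ → A := fun i => x (i + 1)

/-- A finite word `w` appears (as a consecutive subsequence) in the bi-infinite
sequence `x`. -/
def Appears {A : Type*} (w : List A) (x : ℤ → A) : Prop :=
  ∃ k : ℤ, ∀ i : Fin w.length, x (k + (i : ℕ)) = w.get i

/-- `w` belongs to the language of `X`: it appears in some point of `X`. -/
def InLanguage {A : Type*} (X : Set (ℤ → A)) (w : List A) : Prop :=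
  ∃ x ∈ X, Appears w x

/-- `X` has topological entropy `h`, i.e. `(1/n) · log |B_n(X)| → h`. -/
def HasEntropy {A : Type*} (X : Set (ℤ → A)) (h : ℝ) : Prop :=
  Filter.Tendsto
    (fun n : ℕ => Real.log ({w : List A | w.length = n ∧ InLanguage X w}.ncard) / n)
    Filter.atTop (nhds h)

/-- The set of bi-infinite concatenations `⋯ u₋₁^{n₋₁} u₀^{n₀} u₁^{n₁} ⋯` with
`uᵢ ∈ V`, `nᵢ ∈ S uᵢ` and `(uᵢ, uᵢ₊₁)` an edge of the graph.  The `S`-graph shift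
`X(G,S)` is the closure of this set. -/
def SGraphCore {V : Type*} (Adj : V → V → Prop) (S : V → Set ℕ) : Set (ℤ → V) :=
  {x | ∃ (a : ℤ → V) (t : ℤ → ℤ), StrictMono t ∧
    (∀ i : ℤ, (t (i + 1) - t i).toNat ∈ S (a i)) ∧
    (∀ i : ℤ, Adj (a i) (a (i + 1))) ∧
    (∀ i k : ℤ, t i ≤ k → k < t (i + 1) → x k = a i) ∧
    (∀ m : ℤ, ∃ i : ℤ, t i ≤ m ∧ m < t (i + 1))}

/-- `X` is mixing. -/
def IsMixing {A : Type*} (X : Set (ℤ → A)) : Prop :=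
  ∀ α β : List A, InLanguage X α → InLanguage X β →
    ∃ N : ℕ, ∀ n ≥ N, ∃ γ : List A, γ.length = n ∧ InLanguage X (α ++ γ ++ β)

/-- `X` has the specification property. -/
def HasSpecification {A : Type*} (X : Set (ℤ → A)) : Prop :=
  ∃ N : ℕ, ∀ α β : List A, InLanguage X α → InLanguage X β →
    ∃ γ : List A, γ.length = N ∧ InLanguage X (α ++ γ ++ β)

/-- `X` has the weak specification property. -/
def HasWeakSpecification {A : Type*} (X : Set (ℤ → A)) : Prop :=
  ∃ N : ℕ, ∀ α β : List A, InLanguage X α → InLanguage X β →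
    ∃ γ : List A, γ.length ≤ N ∧ InLanguage X (α ++ γ ++ β)

/-- A word belongs to the language of a closure iff it belongs to the language of the set. -/
theorem inLanguage_closure_iff {A : Type*} [TopologicalSpace A] [DiscreteTopology A]
    {C : Set (ℤ → A)} {w : List A} : InLanguage (closure C) w ↔ InLanguage C w := by
  constructor
  · rintro ⟨x, hx, k, hk⟩
    have hopen : IsOpen {y : ℤ → A | ∀ i : Fin w.length, y (k + (i : ℕ)) = w.get i} := by
      rw [Set.ofPred_forall]
      refine isOpen_iInter_of_finite fun i => ?_
      have hcont : Continuous fun y : ℤ → A => y (k + (i : ℕ)) := continuous_apply _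
      exact (isOpen_discrete {w.get i}).preimage hcont
    obtain ⟨y, hy, hyC⟩ := mem_closure_iff.1 hx _ hopen hk
    exact ⟨y, hyC, k, hy⟩
  · rintro ⟨x, hx, h⟩
    exact ⟨x, subset_closure hx, h⟩

/-- A word of the language extends to the right by any number of letters. -/
theorem InLanguage.exists_append {A : Type*} {X : Set (ℤ → A)} {α : List A}
    (h : InLanguage X α) (n : ℕ) : ∃ δ : List A, δ.length = n ∧ InLanguage X (α ++ δ) := by
  obtain ⟨x, hx, k, hk⟩ := h
  refine ⟨List.ofFn fun j : Fin n => x (k + α.length + (j : ℕ)), by simp, x, hx, k, ?_⟩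
  rintro ⟨i, hi⟩
  by_cases hia : i < α.length
  · simpa [List.getElem_append, hia] using hk ⟨i, hia⟩
  · simp only [List.get_eq_getElem, List.getElem_append, hia, dite_false, List.getElem_ofFn]
    congr 1
    omega

theorem HasSpecification.hasWeakSpecification {A : Type*} {X : Set (ℤ → A)}
    (h : HasSpecification X) : HasWeakSpecification X := by
  obtain ⟨N, hN⟩ := h
  refine ⟨N, fun α β hα hβ => ?_⟩
  obtain ⟨γ, hγ, h⟩ := hN α β hα hβ
  exact ⟨γ, hγ.le, h⟩

theorem HasSpecification.isMixing {A : Type*} {X : Set (ℤ → A)}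
    (h : HasSpecification X) : IsMixing X := by
  obtain ⟨N, hN⟩ := h
  refine fun α β hα hβ => ⟨N, fun n hn => ?_⟩
  obtain ⟨δ, hδ, hαδ⟩ := hα.exists_append (n - N)
  obtain ⟨γ, hγ, h⟩ := hN _ β hαδ hβ
  exact ⟨δ ++ γ, by simp; omega, by simpa using h⟩

/-- A mixing shift with weak specification and a synchronizing word has specification. -/
theorem hasSpecification_of_synchronizing {A : Type*} {X : Set (ℤ → A)} {w : List A}
    (hw : InLanguage X w)
    (hsync : ∀ α β : List A, InLanguage X (α ++ w) → InLanguage X (w ++ β) →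
      InLanguage X (α ++ w ++ β))
    (hmix : IsMixing X) (hweak : HasWeakSpecification X) : HasSpecification X := by
  obtain ⟨M, hM⟩ := hmix w w hw hw
  obtain ⟨N, hN⟩ := hweak
  refine ⟨M + 2 * N + 2 * w.length, fun α β hα hβ => ?_⟩
  obtain ⟨γ₁, h₁, hl⟩ := hN α w hα hw
  obtain ⟨γ₂, h₂, hr⟩ := hN w β hw hβ
  obtain ⟨γ, hγ, hc⟩ := hM (M + (N - γ₁.length) + (N - γ₂.length)) (by omega)
  have hlc := hsync (α ++ γ₁) (γ ++ w) hl (by simpa using hc)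
  have hlcr := hsync (α ++ γ₁ ++ w ++ γ) (γ₂ ++ β) (by simpa using hlc) (by simpa using hr)
  refine ⟨γ₁ ++ w ++ γ ++ w ++ γ₂, by simp; omega, by simpa using hlcr⟩

/-- A letter change in a concatenation of blocks is a block boundary; the blocks can be
reindexed so that it is the boundary of index `0`, at position `0`. -/
theorem exists_blocks_of_ne {V : Type*} {Adj : V → V → Prop} {S : V → Set ℕ} {x : ℤ → V}
    (hx : x ∈ SGraphCore Adj S) {p : ℤ} (hp : x (p - 1) ≠ x p) :
    ∃ (a : ℤ → V) (t : ℤ → ℤ), t 0 = 0 ∧ StrictMono t ∧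
      (∀ i : ℤ, (t (i + 1) - t i).toNat ∈ S (a i)) ∧
      (∀ i : ℤ, Adj (a i) (a (i + 1))) ∧
      (∀ i k : ℤ, t i ≤ k → k < t (i + 1) → x (p + k) = a i) ∧
      (∀ m : ℤ, ∃ i : ℤ, t i ≤ m ∧ m < t (i + 1)) := by
  obtain ⟨a, t, ht, hS, hA, hxa, hc⟩ := hx
  obtain ⟨i₀, hi, hi'⟩ := hc p
  have h0 : t i₀ = p := by
    by_contra hne
    exact hp ((hxa i₀ (p - 1) (by omega) (by omega)).trans (hxa i₀ p hi hi').symm)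
  refine ⟨fun j => a (j + i₀), fun j => t (j + i₀) - p, by simp [h0], fun i j hij => ?_,
    fun i => ?_, fun i => ?_, fun i k hk hk' => ?_, fun m => ?_⟩
  · have := ht (show i + i₀ < j + i₀ by omega)
    simp only
    omega
  · have := hS (i + i₀)
    rw [show i + i₀ + 1 = i + 1 + i₀ by ring] at this
    simpa using this
  · have := hA (i + i₀)
    rwa [show i + i₀ + 1 = i + 1 + i₀ by ring] at this
  · simp only at hk hk'
    refine hxa _ _ (by omega) ?_
    rw [show i + i₀ + 1 = i + 1 + i₀ by ring]
    omega
  · obtain ⟨i, hl, hr⟩ := hc (p + m)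
    refine ⟨i - i₀, ?_, ?_⟩
    · simp only [sub_add_cancel]
      omega
    · simp only [show i - i₀ + 1 + i₀ = i + 1 by ring]
      omega

/-- Two concatenations of blocks with the same letter change can be glued along it. -/
theorem glue_mem_SGraphCore {V : Type*} {Adj : V → V → Prop} {S : V → Set ℕ} {x y : ℤ → V}
    (hx : x ∈ SGraphCore Adj S) (hy : y ∈ SGraphCore Adj S) {p q : ℤ}
    (hp : x (p - 1) ≠ x p) (hl : y (q - 1) = x (p - 1)) (hr : y q = x p) :
    (fun k => if k < 0 then x (p + k) else y (q + k)) ∈ SGraphCore Adj S := by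
  obtain ⟨a, t, t0, ht, hS, hA, hxa, hc⟩ := exists_blocks_of_ne hx hp
  obtain ⟨b, s, s0, hs, hS', hA', hyb, hc'⟩ :=
    exists_blocks_of_ne hy (p := q) (by rwa [hl, hr])
  have hab : a 0 = b 0 := by
    rw [← hxa 0 0 t0.le (t0 ▸ ht (by omega)), ← hyb 0 0 s0.le (s0 ▸ hs (by omega))]
    simpa using hr.symm
  refine ⟨fun j => if j < 0 then a j else b j, fun j => if j < 0 then t j else s j,
    fun i j hij => ?_, fun i => ?_, fun i => ?_, fun i k hk hk' => ?_, fun m => ?_⟩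
  · rcases lt_or_ge j 0 with hj | hj
    · simpa [hj, hij.trans hj] using ht hij
    · rcases lt_or_ge i 0 with hi | hi
      · have h1 := ht hi
        have h2 := hs.monotone hj
        simp only [hi, hj.not_gt, if_true, if_false]
        omega
      · simpa [hi.not_gt, hj.not_gt] using hs hij
  · rcases lt_trichotomy i (-1) with hi | rfl | hi
    · simpa [show i < 0 by omega, show i + 1 < 0 by omega] using hS i
    · simpa [t0, s0] using hS (-1)
    · simpa [show ¬ i < 0 by omega, show ¬ i + 1 < 0 by omega] using hS' i
  · rcases lt_trichotomy i (-1) with hi | rfl | hi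
    · simpa [show i < 0 by omega, show i + 1 < 0 by omega] using hA i
    · simpa [hab] using hA (-1)
    · simpa [show ¬ i < 0 by omega, show ¬ i + 1 < 0 by omega] using hA' i
  · rcases lt_trichotomy i (-1) with hi | rfl | hi
    · simp only [show i < 0 by omega, show i + 1 < 0 by omega, if_true] at hk hk' ⊢
      have := ht (show i + 1 < 0 by omega)
      rw [if_pos (by omega)]
      exact hxa i k hk hk'
    · simp [s0] at hk hk' ⊢
      rw [if_pos hk']
      exact hxa (-1) k hk (by simpa [t0] using hk')
    · simp only [show ¬ i < 0 by omega, show ¬ i + 1 < 0 by omega, if_false] at hk hk' ⊢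
      have := hs.monotone (show 0 ≤ i by omega)
      rw [if_neg (by omega)]
      exact hyb i k hk hk'
  · rcases lt_or_ge m 0 with hm | hm
    · obtain ⟨i, h1, h2⟩ := hc m
      have hi : i < 0 := ht.lt_iff_lt.1 (by omega)
      refine ⟨i, by simpa [hi] using h1, ?_⟩
      rcases lt_or_ge (i + 1) 0 with hi' | hi'
      · simpa [hi'] using h2
      · obtain rfl : i = -1 := by omega
        simpa [s0] using hm
    · obtain ⟨i, h1, h2⟩ := hc' m
      have hi : 0 < i + 1 := hs.lt_iff_lt.1 (by omega)
      exact ⟨i, by simpa [show ¬ i < 0 by omega] using h1, by simpa [hi.not_gt] using h2⟩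

/-- A two-letter word with distinct letters is synchronizing for concatenations of blocks. -/
theorem inLanguage_SGraphCore_append_pair_append {V : Type*} {Adj : V → V → Prop}
    {S : V → Set ℕ} {u v : V} (huv : u ≠ v) {α β : List V}
    (hα : InLanguage (SGraphCore Adj S) (α ++ [u, v]))
    (hβ : InLanguage (SGraphCore Adj S) ([u, v] ++ β)) :
    InLanguage (SGraphCore Adj S) (α ++ [u, v] ++ β) := by
  obtain ⟨x, hx, k, hk⟩ := hα
  obtain ⟨y, hy, l, hl⟩ := hβ
  have hxu : x (k + α.length) = u := by
    simpa using hk ⟨α.length, by simp⟩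
  have hxv : x (k + α.length + 1) = v := by
    simpa [List.getElem_append, add_assoc] using hk ⟨α.length + 1, by simp⟩
  have hyu : y l = u := by simpa using hl ⟨0, by simp⟩
  have hyv : y (l + 1) = v := by simpa using hl ⟨1, by simp⟩
  refine ⟨_, glue_mem_SGraphCore hx hy (p := k + α.length + 1) (q := l + 1)
    (by simpa [hxu, hxv] using huv) (by simp [hxu, hyu]) (by simp [hxv, hyv]),
    -1 - α.length, ?_⟩
  rintro ⟨i, hi⟩
  simp only [List.length_append, List.length_cons, List.length_nil] at hi
  rcases lt_or_ge i (α.length + 1) with h | h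
  · have := hk ⟨i, by simp; omega⟩
    simp only [List.get_eq_getElem] at this ⊢
    rw [if_pos (by omega), List.getElem_append_left (by simp; omega), ← this]
    congr 1
    ring
  · have := hl ⟨i - α.length, by simp; omega⟩
    simp only [List.get_eq_getElem] at this ⊢
    simp only [List.append_assoc]
    rw [if_neg (by omega), List.getElem_append_right (by omega), ← this]
    congr 1
    omega

/-- A nonempty core has a word of two adjacent vertices in its language. -/
theorem exists_adj_inLanguage_pair {V : Type*} {Adj : V → V → Prop} {S : V → Set ℕ}
    {x : ℤ → V} (hx : x ∈ SGraphCore Adj S) :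
    ∃ u v, Adj u v ∧ InLanguage (SGraphCore Adj S) [u, v] := by
  obtain ⟨a, t, ht, -, hA, hxa, -⟩ := id hx
  have h0 := ht (show (-1 : ℤ) < 0 by omega)
  have h1 := ht (show (0 : ℤ) < 1 by omega)
  refine ⟨a (-1), a 0, by simpa using hA (-1), x, hx, t 0 - 1, ?_⟩
  intro i
  fin_cases i
  · simpa using hxa (-1) (t 0 - 1) (by omega) (by simp)
  · simpa using hxa 0 (t 0) le_rfl (by simpa using h1)

/-- **Specification for S-graph shifts.**  An `S`-graph shift `X(G,S)`, with
`(G,S)` an essential set-equipped graph, has the specification property iff it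
is mixing and has the weak specification property. -/
theorem hasSpecification_SGraphShift_iff {V : Type*} [Fintype V]
    [TopologicalSpace V] [DiscreteTopology V]
    (Adj : V → V → Prop) (S : V → Set ℕ)
    (hLoop : ∀ v, ¬ Adj v v)
    (hNe : ∀ v, (S v).Nonempty) (hPos : ∀ v, 0 ∉ S v)
    (hEss : ∀ v : V, (∃ u, Adj u v) ∧ (∃ w, Adj v w)) :
    HasSpecification (closure (SGraphCore Adj S)) ↔
      (IsMixing (closure (SGraphCore Adj S)) ∧
        HasWeakSpecification (closure (SGraphCore Adj S))) := by
  refine ⟨fun h => ⟨h.isMixing, h.hasWeakSpecification⟩, fun ⟨hmix, hweak⟩ => ?_⟩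
  rcases (SGraphCore Adj S).eq_empty_or_nonempty with he | ⟨x, hx⟩
  · refine ⟨0, fun α β hα _ => ?_⟩
    obtain ⟨x, hx, -⟩ := hα
    simp [he] at hx
  · obtain ⟨u, v, huv, hw⟩ := exists_adj_inLanguage_pair hx
    have hne : u ≠ v := fun h => hLoop v (h ▸ huv)
    refine hasSpecification_of_synchronizing (inLanguage_closure_iff.2 hw)
      (fun α β hα hβ => ?_) hmix hweak
    rw [inLanguage_closure_iff] at hα hβ ⊢
    exact inLanguage_SGraphCore_append_pair_append hne hα hβ
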